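/- arXiv:1505.02903 — 2 statements merged into one kernel-verified Lean document; each statement's English description precedes it below -/
import Mathlib

section
/- Let m ≥ 1 and n ≥ 1, let X ⊂ ℝⁿ be the n-dimensional QAM constellation with parameter m, and let Q be a real orthogonal n×n matrix. Then the following are equivalent: (i) for all distinct x, y ∈ X with Euclidean distance ‖x - y‖ ≤ 2 and every coordinate index i, the i-th coordinates of Qx and Qy differ (i.e., (Qx)_i ≠ (Qy)_i); (ii) every entry of Q is nonzero. (In the paper's terminology, (i) says the rotated constellation QX has local diversity order n at radius r = 2, i.e., is locally fully diverse.) -/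
open Matrix

/-- The `n`-dimensional QAM constellation with parameter `m`: all vectors each of whose
coordinates is an odd integer of absolute value at most `2 * m - 1`. -/
def QAM (n m : ℕ) : Set (Fin n → ℝ) :=
  {x | ∀ i, ∃ z : ℤ, Odd z ∧ |z| ≤ 2 * (m : ℤ) - 1 ∧ x i = (z : ℝ)}

theorem QAM.four_le_sq_sub {n m : ℕ} {x y : Fin n → ℝ} (hx : x ∈ QAM n m) (hy : y ∈ QAM n m)
    {i : Fin n} (h : x i ≠ y i) : 4 ≤ (x i - y i) ^ 2 := by
  obtain ⟨a, ⟨b, rfl⟩, -, ha⟩ := hx i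
  obtain ⟨c, ⟨d, rfl⟩, -, hc⟩ := hy i
  have hbd : b - d ≠ 0 := by
    intro hbd
    rw [sub_eq_zero.mp hbd, ← hc] at ha
    exact h ha
  have hone : (1 : ℝ) ≤ ((b : ℝ) - d) ^ 2 := by
    exact_mod_cast Int.add_one_le_iff.mpr (sq_pos_of_ne_zero hbd)
  rw [ha, hc]
  push_cast
  linarith

/-- Distinct constellation points at distance at most `2` differ in exactly one coordinate. -/
theorem QAM.exists_sub_eq_single {n m : ℕ} {x y : Fin n → ℝ} (hx : x ∈ QAM n m)
    (hy : y ∈ QAM n m) (hne : x ≠ y) (hdist : Real.sqrt (∑ i, (x i - y i) ^ 2) ≤ 2) :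
    ∃ j, ∃ c : ℝ, c ≠ 0 ∧ x - y = Pi.single j c := by
  obtain ⟨j, hj⟩ := Function.ne_iff.mp hne
  refine ⟨j, x j - y j, sub_ne_zero.mpr hj, funext fun k => ?_⟩
  rcases eq_or_ne k j with rfl | hkj
  · simp
  rw [Pi.single_eq_of_ne hkj, Pi.sub_apply, sub_eq_zero]
  by_contra hk
  have hpair := Finset.sum_le_sum_of_subset_of_nonneg (Finset.subset_univ {k, j})
    fun i _ _ => sq_nonneg (x i - y i)
  rw [Finset.sum_pair hkj] at hpair
  have hsum := (Real.sqrt_le_left (by norm_num)).mp hdist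
  linarith [QAM.four_le_sq_sub hx hy hj, QAM.four_le_sq_sub hx hy hk]

theorem QAM.mem_of_forall_eq_one_or_neg_one {n m : ℕ} (hm : 1 ≤ m) {x : Fin n → ℝ}
    (h : ∀ i, x i = 1 ∨ x i = -1) : x ∈ QAM n m := by
  intro i
  rcases h i with hi | hi
  · exact ⟨1, by decide, by rw [abs_one]; omega, by simp [hi]⟩
  · exact ⟨-1, by decide, by rw [abs_neg, abs_one]; omega, by simp [hi]⟩

/-- A rotated QAM constellation `Q • X` has local diversity order `n` at radius `2`
(is locally fully diverse) if and only if every entry of `Q` is nonzero. -/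
theorem qam_locally_fully_diverse_iff (m n : ℕ) (hm : 1 ≤ m) (hn : 1 ≤ n)
    (Q : Matrix (Fin n) (Fin n) ℝ) (hQ : Q * Qᵀ = 1) :
    (∀ x ∈ QAM n m, ∀ y ∈ QAM n m, x ≠ y →
        Real.sqrt (∑ i, (x i - y i) ^ 2) ≤ 2 →
          ∀ i, Q.mulVec x i ≠ Q.mulVec y i) ↔
      ∀ i j, Q i j ≠ 0 := by
  constructor
  · intro h i j hij
    set x : Fin n → ℝ := fun _ => 1 with hx
    set y : Fin n → ℝ := Function.update x j (-1) with hy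
    have hsub : x - y = Pi.single j 2 := by
      ext k
      rcases eq_or_ne k j with rfl | hk
      · norm_num [hx, hy]
      · simp [hx, hy, hk]
    refine h x (QAM.mem_of_forall_eq_one_or_neg_one hm fun _ => Or.inl rfl) y
      (QAM.mem_of_forall_eq_one_or_neg_one hm fun k => ?_) ?_ ?_ i ?_
    · rcases eq_or_ne k j with rfl | hk
      · simp [hy]
      · simp [hx, hy, hk]
    · rw [← sub_ne_zero, hsub]
      simp
    · simp only [← Pi.sub_apply, hsub]
      simp [Pi.single_apply, ite_pow]
    · rw [← sub_eq_zero, ← Pi.sub_apply, ← Matrix.mulVec_sub, hsub]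
      simp [hij]
  · intro h x hx y hy hne hdist i
    obtain ⟨j, c, hc, hsub⟩ := QAM.exists_sub_eq_single hx hy hne hdist
    rw [← sub_ne_zero, ← Pi.sub_apply, ← Matrix.mulVec_sub, hsub]
    simp [hc, h i j]
end

section
/- Let n ≥ 2 be an integer and c > 0 a real number, and define g : [0, π/2] → ℝ by g(t) = (1 + cos²(t)/c) · (1 + sin²(t)/((n-1)c))^{n-1}. Then g attains its maximum on [0, π/2] at the unique point t₀ = arccos(1/√n); that is, for every t ∈ [0, π/2] with t ≠ t₀ one has g(t) < g(t₀). -/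
/-- Strict weighted AM-GM inequality: if `a + m * b = (m + 1) * M` and `b ≠ M`, then
`a * b ^ m < M ^ (m + 1)`. -/
theorem mul_pow_lt_pow_succ_of_add_mul_eq {m : ℕ} (hm : 1 ≤ m) {a b M : ℝ} (hb : 0 < b)
    (hM : 0 < M) (h : a + m * b = (m + 1) * M) (hne : b ≠ M) : a * b ^ m < M ^ (m + 1) := by
  have hm' : (1 : ℝ) ≤ m := by exact_mod_cast hm
  have hs : -1 ≤ M / b - 1 := by linarith [div_pos hM hb]
  have hs' : M / b - 1 ≠ 0 := by
    rw [sub_ne_zero, Ne, div_eq_one_iff_eq hb.ne']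
    exact hne.symm
  have key := one_add_mul_self_lt_rpow_one_add hs hs' (p := ((m + 1 : ℕ) : ℝ))
    (by push_cast; linarith)
  rw [Real.rpow_natCast, add_sub_cancel, div_pow, lt_div_iff₀ (pow_pos hb _)] at key
  calc a * b ^ m = (1 + ((m + 1 : ℕ) : ℝ) * (M / b - 1)) * b ^ (m + 1) := by
        obtain rfl : a = (m + 1) * M - m * b := by linarith
        push_cast
        field_simp
        ring
    _ < M ^ (m + 1) := key

/-- The function `g t = (1 + cos² t / c) * (1 + sin² t / ((n-1) c))^(n-1)` attains its
maximum on `[0, π/2]` at the unique point `t₀ = arccos (1/√n)`. -/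
theorem g_max_at_arccos (n : ℕ) (hn : 2 ≤ n) (c : ℝ) (hc : 0 < c) :
    ∀ t ∈ Set.Icc (0 : ℝ) (Real.pi / 2), t ≠ Real.arccos (1 / Real.sqrt n) →
      (1 + Real.cos t ^ 2 / c) *
          (1 + Real.sin t ^ 2 / (((n : ℝ) - 1) * c)) ^ (n - 1) <
        (1 + Real.cos (Real.arccos (1 / Real.sqrt n)) ^ 2 / c) *
          (1 + Real.sin (Real.arccos (1 / Real.sqrt n)) ^ 2 /
            (((n : ℝ) - 1) * c)) ^ (n - 1) := by
  intro t ⟨ht0, ht1⟩ hne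
  obtain ⟨m, rfl⟩ : ∃ m, n = m + 1 := ⟨n - 1, by omega⟩
  have hm : 1 ≤ m := by omega
  have hmpos : (0 : ℝ) < m := by exact_mod_cast hm
  have hsqrt : 1 ≤ √((m + 1 : ℕ) : ℝ) := by
    rw [Real.one_le_sqrt]
    push_cast
    linarith
  have hcos : Real.cos (Real.arccos (1 / √((m + 1 : ℕ) : ℝ))) = 1 / √((m + 1 : ℕ) : ℝ) := by
    refine Real.cos_arccos (le_trans (by norm_num) (by positivity : (0 : ℝ) ≤ _)) ?_
    exact (div_le_one (by linarith)).2 hsqrt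
  have hcos_sq : (1 / √((m + 1 : ℕ) : ℝ)) ^ 2 = 1 / ((m : ℝ) + 1) := by
    rw [div_pow, Real.sq_sqrt (Nat.cast_nonneg _)]
    push_cast
    ring
  have hx : Real.cos t ^ 2 ≠ 1 / ((m : ℝ) + 1) := by
    intro h
    apply hne
    rw [← hcos_sq, sq_eq_sq₀ (Real.cos_nonneg_of_mem_Icc ⟨by linarith, ht1⟩)
      (by positivity)] at h
    rw [← h, Real.arccos_cos ht0 (by linarith [Real.pi_pos])]
  have hx1 := Real.cos_sq_le_one t
  rw [Real.sin_sq, Real.sin_sq, hcos, hcos_sq]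
  generalize Real.cos t ^ 2 = x at hx hx1
  have hmax : 1 + (1 - 1 / ((m : ℝ) + 1)) / ((((m + 1 : ℕ) : ℝ) - 1) * c) =
      1 + 1 / ((m : ℝ) + 1) / c := by
    push_cast
    rw [add_sub_cancel_right]
    field_simp
    ring
  rw [hmax, Nat.add_sub_cancel, ← pow_succ']
  push_cast
  rw [add_sub_cancel_right]
  have hx1' : 0 ≤ 1 - x := by linarith
  refine mul_pow_lt_pow_succ_of_add_mul_eq hm (by positivity) (by positivity) ?_ ?_
  · field_simp
    ring
  · intro h
    apply hx
    field_simp at h ⊢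
    linarith
end
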